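/- Inserting a customer into a route cannot decrease its expected cost under optimal restocking: let r = (v_0, v_{s_1},…,v_{s_l}, v_0) be a route and let r' = (v_0, v_{s_1},…,v_{s_t}, v_u, v_{s_{t+1}},…,v_{s_l}, v_0) be obtained from r by inserting a customer v_u at some position t ∈ {0,…,l} (insertion immediately after the depot or after any customer, with the convention that insertion at position l places v_u just before the final return to the depot). Then c_{r'} ≥ c_r. -/

import Mathlib

/-- `Ψ(k,q) = max(⌈(k−q)/Q⌉, 0)`: number of replenishment trips of capacity `Q`
needed to fulfill a demand of `k` with remaining quantity `q`. -/
noncomputable def psi (Q k q : ℕ) : ℤ :=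
  max ⌈((k : ℚ) - (q : ℚ)) / (Q : ℚ)⌉ 0

/-- The value functions `ν^r(i,q)` of a route `r = (v_0, v_{t_1},…,v_{t_h}, v_0)`
(with `t 0 = 0`), computed by backward recursion on the fuel `h − i`:
`nuF Q d p t (h - i) i q = ν^r(i,q)`. -/
noncomputable def nuF (Q : ℕ) (d p : ℕ → ℕ → ℝ) (s : ℕ → ℕ) :
    ℕ → ℕ → ℕ → ℝ
  | 0, i, _ => d (s i) 0
  | j + 1, i, q =>
      min
        (d (s i) (s (i + 1)) + ∑' k : ℕ,
          ((d (s (i + 1)) 0 + d 0 (s (i + 1))) * (psi Q k q : ℝ)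
            + nuF Q d p s j (i + 1)
                ((Q : ℤ) * psi Q k q + (q : ℤ) - (k : ℤ)).toNat) * p (s (i + 1)) k)
        (d (s i) 0 + d 0 (s (i + 1)) + ∑' k : ℕ,
          ((d (s (i + 1)) 0 + d 0 (s (i + 1))) * (psi Q k Q : ℝ)
            + nuF Q d p s j (i + 1)
                ((Q : ℤ) * psi Q k Q + (Q : ℤ) - (k : ℤ)).toNat) * p (s (i + 1)) k)

/-- The node sequence of the route visiting the customers of the list `t` in
order (node `0` is the depot, node `j ≥ 1` is the `j`-th customer of `t`). -/
def routeSeq (t : List ℕ) : ℕ → ℕ := fun j => if j = 0 then 0 else t.getD (j - 1) 0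

/-- Expected cost `c_r = ν^r(0,Q)` of the route visiting the customers of `t`
in order, under optimal restocking. -/
noncomputable def routeCost (Q : ℕ) (d p : ℕ → ℕ → ℝ) (t : List ℕ) : ℝ :=
  nuF Q d p (routeSeq t) t.length 0 Q

/-- The quantity left in the vehicle after serving a demand `k` starting from `q`. -/
noncomputable def leftover (Q k q : ℕ) : ℕ :=
  ((Q : ℤ) * psi Q k q + (q : ℤ) - (k : ℤ)).toNat

/-- Expected cost of serving customer `b` on arrival with quantity `q`, including the
continuation cost `f` of the remaining quantity. -/
noncomputable def serveCost (Q : ℕ) (d p : ℕ → ℕ → ℝ) (b : ℕ) (f : ℕ → ℝ) (q : ℕ) : ℝ :=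
  ∑' k : ℕ, ((d b 0 + d 0 b) * (psi Q k q : ℝ) + f (leftover Q k q)) * p b k

/-- Optimal expected cost from node `a` with the customers of a list still to be visited. -/
noncomputable def tailCost (Q : ℕ) (d p : ℕ → ℕ → ℝ) : ℕ → List ℕ → ℕ → ℝ
  | a, [], _ => d a 0
  | a, b :: l, q =>
      min (d a b + serveCost Q d p b (tailCost Q d p b l) q)
        (d a 0 + d 0 b + serveCost Q d p b (tailCost Q d p b l) Q)

theorem nuF_eq_tailCost (Q : ℕ) (d p : ℕ → ℕ → ℝ) (s : ℕ → ℕ) (j i q : ℕ) :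
    nuF Q d p s j i q = tailCost Q d p (s i) ((List.range' (i + 1) j).map s) q := by
  induction j generalizing i q with
  | zero => simp [nuF, tailCost]
  | succ j ih =>
    simp only [nuF, List.range'_succ, List.map_cons, tailCost, serveCost, leftover, ih]

theorem map_routeSeq_range' (t : List ℕ) :
    (List.range' 1 t.length).map (routeSeq t) = t := by
  apply List.ext_getElem
  · simp
  · intro i h₁ h₂
    simp [routeSeq, h₂]

theorem routeCost_eq_tailCost (Q : ℕ) (d p : ℕ → ℕ → ℝ) (t : List ℕ) :
    routeCost Q d p t = tailCost Q d p 0 t Q := by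
  rw [routeCost, nuF_eq_tailCost, zero_add, map_routeSeq_range']
  rfl

theorem psi_nonneg (Q k q : ℕ) : 0 ≤ psi Q k q := le_max_right _ _

theorem sub_le_mul_psi {Q : ℕ} (hQ : 1 ≤ Q) (k q : ℕ) :
    (k : ℤ) - q ≤ Q * psi Q k q := by
  have hQ' : (0 : ℚ) < Q := by exact_mod_cast hQ
  have h : ((k : ℚ) - q) / Q ≤ (psi Q k q : ℚ) :=
    (Int.le_ceil _).trans (Int.cast_le.2 (le_max_left _ _))
  rw [div_le_iff₀ hQ', mul_comm] at h
  exact_mod_cast h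

theorem psi_eq_zero_or_lt {Q : ℕ} (hQ : 1 ≤ Q) (k q : ℕ) :
    psi Q k q = 0 ∨ 1 ≤ psi Q k q ∧ (Q : ℤ) * (psi Q k q - 1) < k - q := by
  have hQ' : (0 : ℚ) < Q := by exact_mod_cast hQ
  rcases le_or_gt ⌈((k : ℚ) - q) / Q⌉ 0 with h | h
  · exact Or.inl (max_eq_right h)
  · right
    have e : psi Q k q = ⌈((k : ℚ) - q) / Q⌉ := max_eq_left h.le
    refine ⟨by omega, ?_⟩
    have h₁ : ((psi Q k q : ℚ) - 1) < ((k : ℚ) - q) / Q := by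
      rw [e]; linarith [Int.ceil_lt_add_one (((k : ℚ) - q) / Q)]
    rw [lt_div_iff₀ hQ', mul_comm] at h₁
    exact_mod_cast h₁

theorem psi_le {Q : ℕ} (hQ : 1 ≤ Q) (k q : ℕ) : psi Q k q ≤ k := by
  rcases psi_eq_zero_or_lt hQ k q with h | ⟨h₁, h₂⟩
  · omega
  · have : (1 : ℤ) * (psi Q k q - 1) ≤ Q * (psi Q k q - 1) :=
      mul_le_mul_of_nonneg_right (by exact_mod_cast hQ) (by omega)
    omega

theorem leftover_cast {Q : ℕ} (hQ : 1 ≤ Q) (k q : ℕ) :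
    (leftover Q k q : ℤ) = Q * psi Q k q + q - k :=
  Int.toNat_of_nonneg (by linarith [sub_le_mul_psi hQ k q])

theorem leftover_le {Q : ℕ} (hQ : 1 ≤ Q) (k : ℕ) {q : ℕ} (hq : q ≤ Q) :
    leftover Q k q ≤ Q := by
  have h := leftover_cast hQ k q
  rcases psi_eq_zero_or_lt hQ k q with h₀ | ⟨_, h₂⟩
  · rw [h₀] at h; omega
  · rw [mul_sub] at h₂; omega

theorem leftover_le_of_psi_eq_zero {Q : ℕ} (hQ : 1 ≤ Q) {k q : ℕ} (h₀ : psi Q k q = 0) :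
    leftover Q k q ≤ q := by
  have h := leftover_cast hQ k q
  rw [h₀] at h; omega

theorem psi_eq_or_succ_le {Q : ℕ} (hQ : 1 ≤ Q) (k : ℕ) {q q' : ℕ} (h : q ≤ q') :
    psi Q k q' = psi Q k q ∧ leftover Q k q ≤ leftover Q k q' ∨
      psi Q k q' + 1 ≤ psi Q k q := by
  have hle : psi Q k q' ≤ psi Q k q := by
    rcases psi_eq_zero_or_lt hQ k q' with h₀ | ⟨_, h₂⟩
    · rw [h₀]; exact psi_nonneg _ _ _
    · have h₃ := sub_le_mul_psi hQ k q
      have : (Q : ℤ) * (psi Q k q' - 1) < Q * psi Q k q := by omega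
      have := lt_of_mul_lt_mul_left this (by positivity)
      omega
  rcases hle.eq_or_lt with e | e
  · refine Or.inl ⟨e, ?_⟩
    have h₁ := leftover_cast hQ k q
    have h₂ := leftover_cast hQ k q'
    rw [e] at h₂; omega
  · exact Or.inr e

/-- The properties of continuation costs at a node with round-trip cost `c` to the depot:
nonnegative, nonincreasing in the quantity on board, and of oscillation at most `c`. -/
structure IsContinuationCost (Q : ℕ) (c : ℝ) (f : ℕ → ℝ) : Prop where
  nonneg : ∀ q, q ≤ Q → 0 ≤ f q
  anti : ∀ q q', q ≤ q' → q' ≤ Q → f q' ≤ f q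
  le_add : ∀ q q', q ≤ Q → q' ≤ Q → f q' ≤ f q + c

/-- A probability mass function on `ℕ` with finite mean. -/
structure IsDemand (w : ℕ → ℝ) : Prop where
  nonneg : ∀ k, 0 ≤ w k
  hasSum : HasSum w 1
  summable_mean : Summable fun k : ℕ => (k : ℝ) * w k

section ServeCost

variable {Q : ℕ} {d p : ℕ → ℕ → ℝ} {b : ℕ} {f g : ℕ → ℝ}

theorem summable_serveCost (hQ : 1 ≤ Q) (hp : IsDemand (p b)) (hc : 0 ≤ d b 0 + d 0 b)
    (hf : IsContinuationCost Q (d b 0 + d 0 b) f) {q : ℕ} (hq : q ≤ Q) :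
    Summable fun k : ℕ =>
      ((d b 0 + d 0 b) * (psi Q k q : ℝ) + f (leftover Q k q)) * p b k := by
  refine Summable.of_nonneg_of_le (fun k => ?_) (fun k => ?_)
    ((hp.summable_mean.mul_left (d b 0 + d 0 b)).add (hp.hasSum.summable.mul_left (f 0)))
  · have h₀ : (0 : ℝ) ≤ psi Q k q := by exact_mod_cast psi_nonneg Q k q
    exact mul_nonneg (add_nonneg (mul_nonneg hc h₀) (hf.nonneg _ (leftover_le hQ k hq)))
      (hp.nonneg k)
  · have h₁ : (psi Q k q : ℝ) ≤ k := by exact_mod_cast psi_le hQ k q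
    have h₂ := hf.anti 0 _ (Nat.zero_le _) (leftover_le hQ k hq)
    calc _ ≤ ((d b 0 + d 0 b) * (k : ℝ) + f 0) * p b k :=
          mul_le_mul_of_nonneg_right
            (add_le_add (mul_le_mul_of_nonneg_left h₁ hc) h₂) (hp.nonneg k)
      _ = _ := by ring

theorem serveCost_anti (hQ : 1 ≤ Q) (hp : IsDemand (p b)) (hc : 0 ≤ d b 0 + d 0 b)
    (hf : IsContinuationCost Q (d b 0 + d 0 b) f) {q q' : ℕ} (h : q ≤ q') (hq' : q' ≤ Q) :
    serveCost Q d p b f q' ≤ serveCost Q d p b f q := by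
  refine Summable.tsum_le_tsum (fun k => mul_le_mul_of_nonneg_right ?_ (hp.nonneg k))
    (summable_serveCost hQ hp hc hf hq') (summable_serveCost hQ hp hc hf (h.trans hq'))
  have hl := leftover_le hQ k (h.trans hq')
  have hl' := leftover_le hQ k hq'
  rcases psi_eq_or_succ_le hQ k h with ⟨e, hle⟩ | hlt
  · rw [e]
    exact add_le_add le_rfl (hf.anti _ _ hle hl')
  · have h₁ : (psi Q k q' : ℝ) + 1 ≤ psi Q k q := by exact_mod_cast hlt
    have h₂ := mul_le_mul_of_nonneg_left h₁ hc
    have h₃ := hf.le_add _ _ hl hl'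
    linarith

theorem serveCost_mono (hQ : 1 ≤ Q) (hp : IsDemand (p b)) (hc : 0 ≤ d b 0 + d 0 b)
    (hf : IsContinuationCost Q (d b 0 + d 0 b) f)
    (hg : IsContinuationCost Q (d b 0 + d 0 b) g) (hfg : ∀ q, q ≤ Q → f q ≤ g q)
    {q : ℕ} (hq : q ≤ Q) :
    serveCost Q d p b f q ≤ serveCost Q d p b g q :=
  Summable.tsum_le_tsum
    (fun k => mul_le_mul_of_nonneg_right
      (add_le_add le_rfl (hfg _ (leftover_le hQ k hq))) (hp.nonneg k))
    (summable_serveCost hQ hp hc hf hq) (summable_serveCost hQ hp hc hg hq)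

/-- Serving a customer costs at least as much as continuing with the quantity on board. -/
theorem le_serveCost (hQ : 1 ≤ Q) (hp : IsDemand (p b)) (hc : 0 ≤ d b 0 + d 0 b)
    (hf : IsContinuationCost Q (d b 0 + d 0 b) f) {q : ℕ} (hq : q ≤ Q) :
    f q ≤ serveCost Q d p b f q := by
  have hs := hp.hasSum.mul_left (f q)
  rw [mul_one] at hs
  rw [← hs.tsum_eq]
  refine Summable.tsum_le_tsum (fun k => mul_le_mul_of_nonneg_right ?_ (hp.nonneg k))
    hs.summable (summable_serveCost hQ hp hc hf hq)
  rcases psi_eq_zero_or_lt hQ k q with h₀ | ⟨h₁, _⟩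
  · have := hf.anti _ _ (leftover_le_of_psi_eq_zero hQ h₀) hq
    simpa [h₀] using this
  · have h₂ : (1 : ℝ) ≤ psi Q k q := by exact_mod_cast h₁
    have h₃ := mul_le_mul_of_nonneg_left h₂ hc
    have h₄ := hf.le_add _ _ (leftover_le hQ k hq) hq
    linarith

end ServeCost

section TailCost

variable {Q N : ℕ} {d p : ℕ → ℕ → ℝ}

theorem tailCost_le_add (htri : ∀ i j k, i ≤ N → j ≤ N → k ≤ N → d i j ≤ d i k + d k j)
    {a x : ℕ} (ha : a ≤ N) (hx : x ≤ N) {l : List ℕ} (hl : ∀ v ∈ l, 1 ≤ v ∧ v ≤ N) (q : ℕ) :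
    tailCost Q d p a l q ≤ d a x + tailCost Q d p x l q := by
  cases l with
  | nil => exact htri a 0 x ha (Nat.zero_le _) hx
  | cons b l =>
    have h₁ := htri a b x ha (hl b (by simp)).2 hx
    have h₂ := htri a 0 x ha (Nat.zero_le _) hx
    simp only [tailCost]
    rw [← min_add_add_left]
    exact min_le_min (by linarith) (by linarith)

theorem tailCost_le_replenish (hd0 : ∀ i j, i ≤ N → j ≤ N → 0 ≤ d i j)
    (a : ℕ) (l : List ℕ) (q : ℕ) :
    tailCost Q d p a l q ≤ d a 0 + tailCost Q d p 0 l Q := by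
  have h := hd0 0 0 (Nat.zero_le _) (Nat.zero_le _)
  cases l with
  | nil => simpa [tailCost] using h
  | cons b l =>
    simp only [tailCost]
    rw [← min_add_add_left]
    refine (min_le_right _ _).trans (le_min (by linarith) (by linarith))

theorem tailCost_isContinuationCost (hQ : 1 ≤ Q)
    (hd0 : ∀ i j, i ≤ N → j ≤ N → 0 ≤ d i j)
    (htri : ∀ i j k, i ≤ N → j ≤ N → k ≤ N → d i j ≤ d i k + d k j)
    (hp : ∀ m, 1 ≤ m → m ≤ N → IsDemand (p m))
    {l : List ℕ} (hl : ∀ v ∈ l, 1 ≤ v ∧ v ≤ N) {a : ℕ} (ha : a ≤ N) :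
    IsContinuationCost Q (d a 0 + d 0 a) (tailCost Q d p a l) := by
  have hround : ∀ v, v ≤ N → 0 ≤ d v 0 + d 0 v := fun v hv =>
    add_nonneg (hd0 _ _ hv (Nat.zero_le _)) (hd0 _ _ (Nat.zero_le _) hv)
  induction l generalizing a with
  | nil =>
    refine ⟨fun q _ => hd0 a 0 ha (Nat.zero_le _), fun _ _ _ _ => le_rfl, fun q q' _ _ => ?_⟩
    have := hround a ha
    simp only [tailCost]
    linarith
  | cons b l ih =>
    obtain ⟨hb₁, hb⟩ := hl b (by simp)
    have hf := ih (fun v hv => hl v (by simp [hv])) hb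
    have hnonneg : ∀ q, q ≤ Q → 0 ≤ serveCost Q d p b (tailCost Q d p b l) q := fun q hq =>
      (hf.nonneg q hq).trans (le_serveCost hQ (hp b hb₁ hb) (hround b hb) hf hq)
    have hanti : ∀ q q', q ≤ q' → q' ≤ Q →
        tailCost Q d p a (b :: l) q' ≤ tailCost Q d p a (b :: l) q := fun q q' h hq' =>
      min_le_min (add_le_add le_rfl
        (serveCost_anti hQ (hp b hb₁ hb) (hround b hb) hf h hq')) le_rfl
    refine ⟨fun q hq => ?_, hanti, fun q q' hq _ => ?_⟩
    · exact le_min (add_nonneg (hd0 a b ha hb) (hnonneg q hq))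
        (add_nonneg (add_nonneg (hd0 a 0 ha (Nat.zero_le _)) (hd0 0 b (Nat.zero_le _) hb))
          (hnonneg Q le_rfl))
    · have h₁ := tailCost_le_replenish (Q := Q) (p := p) hd0 a (b :: l) q'
      have h₂ := tailCost_le_add (Q := Q) (p := p) htri (Nat.zero_le N) ha hl Q
      have h₃ := hanti q Q hq le_rfl
      linarith

theorem tailCost_le_cons (hQ : 1 ≤ Q)
    (hd0 : ∀ i j, i ≤ N → j ≤ N → 0 ≤ d i j)
    (htri : ∀ i j k, i ≤ N → j ≤ N → k ≤ N → d i j ≤ d i k + d k j)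
    (hp : ∀ m, 1 ≤ m → m ≤ N → IsDemand (p m))
    {l : List ℕ} (hl : ∀ v ∈ l, 1 ≤ v ∧ v ≤ N) {u : ℕ} (hu : 1 ≤ u ∧ u ≤ N)
    {a : ℕ} (ha : a ≤ N) {q : ℕ} (hq : q ≤ Q) :
    tailCost Q d p a l q ≤ tailCost Q d p a (u :: l) q := by
  have hc : 0 ≤ d u 0 + d 0 u :=
    add_nonneg (hd0 _ _ hu.2 (Nat.zero_le _)) (hd0 _ _ (Nat.zero_le _) hu.2)
  have hf := tailCost_isContinuationCost hQ hd0 htri hp hl hu.2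
  have hserve : ∀ q, q ≤ Q → _ := fun q hq => le_serveCost hQ (hp u hu.1 hu.2) hc hf (q := q) hq
  refine le_min ?_ ?_
  · exact (tailCost_le_add htri ha hu.2 hl q).trans (add_le_add le_rfl (hserve q hq))
  · have h₁ := tailCost_le_replenish (Q := Q) (p := p) hd0 a l q
    have h₂ := tailCost_le_add (Q := Q) (p := p) htri (Nat.zero_le N) hu.2 hl Q
    have h₃ := hserve Q le_rfl
    linarith

theorem tailCost_append_le_insert (hQ : 1 ≤ Q)
    (hd0 : ∀ i j, i ≤ N → j ≤ N → 0 ≤ d i j)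
    (htri : ∀ i j k, i ≤ N → j ≤ N → k ≤ N → d i j ≤ d i k + d k j)
    (hp : ∀ m, 1 ≤ m → m ≤ N → IsDemand (p m))
    {l₁ l₂ : List ℕ} (hl₁ : ∀ v ∈ l₁, 1 ≤ v ∧ v ≤ N) (hl₂ : ∀ v ∈ l₂, 1 ≤ v ∧ v ≤ N)
    {u : ℕ} (hu : 1 ≤ u ∧ u ≤ N) {a : ℕ} (ha : a ≤ N) {q : ℕ} (hq : q ≤ Q) :
    tailCost Q d p a (l₁ ++ l₂) q ≤ tailCost Q d p a (l₁ ++ u :: l₂) q := by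
  induction l₁ generalizing a q with
  | nil => exact tailCost_le_cons hQ hd0 htri hp hl₂ hu ha hq
  | cons b l₁ ih =>
    obtain ⟨hb₁, hb⟩ := hl₁ b (by simp)
    have hl₁' : ∀ v ∈ l₁, 1 ≤ v ∧ v ≤ N := fun v hv => hl₁ v (by simp [hv])
    have hc : 0 ≤ d b 0 + d 0 b :=
      add_nonneg (hd0 _ _ hb (Nat.zero_le _)) (hd0 _ _ (Nat.zero_le _) hb)
    have hf := tailCost_isContinuationCost (l := l₁ ++ l₂) hQ hd0 htri hp
      (by simp only [List.mem_append]; rintro v (h | h); exacts [hl₁' v h, hl₂ v h]) hb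
    have hg := tailCost_isContinuationCost (l := l₁ ++ u :: l₂) hQ hd0 htri hp
      (by
        simp only [List.mem_append, List.mem_cons]
        rintro v (h | rfl | h)
        exacts [hl₁' v h, hu, hl₂ v h]) hb
    have hserve : ∀ q, q ≤ Q → _ := fun q hq =>
      serveCost_mono hQ (hp b hb₁ hb) hc hf hg (fun q hq => ih hl₁' hb hq) (q := q) hq
    exact min_le_min (add_le_add le_rfl (hserve q hq)) (add_le_add le_rfl (hserve Q le_rfl))

end TailCost

/-- inserting a customer into a route cannot decrease its
expected cost under optimal restocking: if `r'` is obtained from the route `r`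
(visiting the customers of `t` in order) by inserting a customer `u` at any
position `pos ∈ {0,…,l}` (i.e. `t' = t.take pos ++ u :: t.drop pos`), then
`c_{r'} ≥ c_r`. -/
theorem stmt11 (Q N : ℕ) (hQ : 1 ≤ Q)
    (d : ℕ → ℕ → ℝ) (hd0 : ∀ i j, i ≤ N → j ≤ N → 0 ≤ d i j)
    (htri : ∀ i j k, i ≤ N → j ≤ N → k ≤ N → d i j ≤ d i k + d k j)
    (p : ℕ → ℕ → ℝ)
    (hp : ∀ m, 1 ≤ m → m ≤ N →
      (∀ k, 0 ≤ p m k) ∧ HasSum (p m) 1 ∧ Summable fun k : ℕ => (k : ℝ) * p m k)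
    (t : List ℕ) (ht : t ≠ []) (htC : ∀ v ∈ t, 1 ≤ v ∧ v ≤ N)
    (u : ℕ) (hu : 1 ≤ u ∧ u ≤ N)
    (pos : ℕ) (hpos : pos ≤ t.length) :
    routeCost Q d p t ≤ routeCost Q d p (t.take pos ++ u :: t.drop pos) := by
  rw [routeCost_eq_tailCost, routeCost_eq_tailCost]
  conv_lhs => rw [← List.take_append_drop pos t]
  exact tailCost_append_le_insert hQ hd0 htri
    (fun m h₁ h₂ => ⟨(hp m h₁ h₂).1, (hp m h₁ h₂).2.1, (hp m h₁ h₂).2.2⟩)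
    (fun v hv => htC v (List.mem_of_mem_take hv)) (fun v hv => htC v (List.mem_of_mem_drop hv))
    hu (Nat.zero_le N) le_rfl
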